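/- arXiv:1911.07823 — 6 statements merged into one kernel-verified Lean document; each statement's English description precedes it below -/
import Mathlib

section
/- Let G be a cost minimization game that is (λ,μ)-generalized smooth for some λ > 0, μ < 1, and let σ be a probability distribution on 𝒜 that is an average coarse-correlated equilibrium, i.e., for every a' ∈ 𝒜: ∑_{a∈𝒜} σ_a·∑_{i∈N} J_i(a) ≤ ∑_{a∈𝒜} σ_a·∑_{i∈N} J_i(a_i', a_{−i}). Then for every a' ∈ 𝒜, the expected system cost satisfies ∑_{a∈𝒜} σ_a·C(a) ≤ (λ/(1−μ))·C(a'). In particular the generalized smoothness efficiency bound λ/(1−μ) extends from pure Nash equilibria to all average coarse-correlated equilibria (hence to mixed Nash, correlated, and coarse-correlated equilibria). -/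
open Finset

variable {n : ℕ} {A : Fin n → Type*}

/-- `a` is a pure Nash equilibrium of the cost minimization game with user costs `J`. -/
def IsNE (J : Fin n → (∀ i, A i) → ℝ) (a : ∀ i, A i) : Prop :=
  ∀ (i : Fin n) (b : A i), J i a ≤ J i (Function.update a i b)

/-- The game `(C, J)` is `(lam, mu)`-generalized smooth. -/
def GenSmooth (C : (∀ i, A i) → ℝ) (J : Fin n → (∀ i, A i) → ℝ) (lam mu : ℝ) : Prop :=
  ∀ a a' : ∀ i, A i,
    (∑ i, J i (Function.update a i (a' i))) - (∑ i, J i a) + C a ≤ lam * C a' + mu * C a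

/-- The game `(C, J)` is `(lam, mu)`-smooth (Roughgarden's original notion). -/
def SmoothG (C : (∀ i, A i) → ℝ) (J : Fin n → (∀ i, A i) → ℝ) (lam mu : ℝ) : Prop :=
  (∀ a, C a ≤ ∑ i, J i a) ∧
    ∀ a a' : ∀ i, A i, (∑ i, J i (Function.update a i (a' i))) ≤ lam * C a' + mu * C a

/-- Price of anarchy: worst equilibrium cost over optimal cost. -/
noncomputable def PoA (C : (∀ i, A i) → ℝ) (J : Fin n → (∀ i, A i) → ℝ) : ℝ :=
  sSup {x | ∃ a, IsNE J a ∧ x = C a} / sInf (Set.range C)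

/-- Generalized price of anarchy: best bound obtainable by a generalized smoothness argument. -/
noncomputable def GPoA (C : (∀ i, A i) → ℝ) (J : Fin n → (∀ i, A i) → ℝ) : ℝ :=
  sInf {x | ∃ lam mu : ℝ, 0 < lam ∧ mu < 1 ∧ GenSmooth C J lam mu ∧ x = lam / (1 - mu)}

/-- Robust price of anarchy: best bound obtainable by an original smoothness argument. -/
noncomputable def RPoA (C : (∀ i, A i) → ℝ) (J : Fin n → (∀ i, A i) → ℝ) : ℝ :=
  sInf {x | ∃ lam mu : ℝ, 0 < lam ∧ mu < 1 ∧ SmoothG C J lam mu ∧ x = lam / (1 - mu)}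

/-- In a `(lam, mu)`-generalized smooth game, every average coarse-correlated
equilibrium `σ` has expected system cost at most `lam / (1 - mu) * C a'` for every `a'`. -/
theorem genSmooth_acce_bound {n : ℕ} {A : Fin n → Type*}
    [∀ i, Fintype (A i)]
    (C : (∀ i, A i) → ℝ) (J : Fin n → (∀ i, A i) → ℝ)
    (hC : ∀ a, 0 < C a)
    (lam mu : ℝ) (hlam : 0 < lam) (hmu : mu < 1)
    (hgs : GenSmooth C J lam mu)
    (σ : (∀ i, A i) → ℝ) (hσ0 : ∀ a, 0 ≤ σ a) (hσ1 : ∑ a, σ a = 1)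
    (hacce : ∀ a' : ∀ i, A i,
      (∑ a, σ a * ∑ i, J i a) ≤ ∑ a, σ a * ∑ i, J i (Function.update a i (a' i))) :
    ∀ a' : ∀ i, A i, (∑ a, σ a * C a) ≤ lam / (1 - mu) * C a' := by
  intro a'
  have hsum : ∑ a, σ a * ((∑ i, J i (Function.update a i (a' i))) - (∑ i, J i a) + C a) ≤
      ∑ a, σ a * (lam * C a' + mu * C a) :=
    Finset.sum_le_sum fun a _ => mul_le_mul_of_nonneg_left (hgs a a') (hσ0 a)
  have hright : ∑ a, σ a * (lam * C a' + mu * C a) = lam * C a' + mu * ∑ a, σ a * C a := by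
    simp only [mul_add, Finset.sum_add_distrib, ← Finset.sum_mul, hσ1, one_mul,
      mul_left_comm _ mu, ← Finset.mul_sum]
  rw [hright] at hsum
  simp only [mul_add, mul_sub, Finset.sum_add_distrib, Finset.sum_sub_distrib] at hsum
  rw [div_mul_eq_mul_div, le_div_iff₀ (sub_pos.mpr hmu)]
  linarith [hacce a']
end

section
/- Let G be a generalized congestion game with user set N = {1,…,n} and resource set ℛ. For any two allocations a, a' ∈ 𝒜, define for each r ∈ ℛ: x_r = |a|_r, y_r = |a'|_r, and z_r = #{i ∈ N : r ∈ a_i and r ∈ a_i'}. Then the total cost experienced after unilateral deviations satisfies ∑_{i∈N} J_i(a_i', a_{−i}) = ∑_{r∈ℛ} [ (y_r − z_r)·F_r(x_r + 1) + z_r·F_r(x_r) ]. Moreover, for every r ∈ ℛ, the triple (x_r, y_r, z_r) satisfies 1 ≤ x_r + y_r − z_r ≤ n or x_r = y_r = z_r = 0, and z_r ≤ min(x_r, y_r). -/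
open Finset

/-- A generalized congestion game with user set `Fin n`. -/
structure GCG (n : ℕ) where
  R : Type
  finR : Fintype R
  decR : DecidableEq R
  act : Fin n → Finset (Finset R)
  act_ne : ∀ i, (act i).Nonempty
  Cr : R → ℕ → ℝ
  Fr : R → ℕ → ℝ
  Cr_nonneg : ∀ r k, 0 ≤ Cr r k
  Cr_zero : ∀ r, Cr r 0 = 0
  Fr_zero : ∀ r, Fr r 0 = 0
  Fr_top : ∀ r, Fr r (n + 1) = 0

attribute [instance] GCG.finR GCG.decR

namespace GCG

variable {n : ℕ}

/-- The number of users selecting resource `r` in allocation `a`. -/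
def load (G : GCG n) (a : Fin n → Finset G.R) (r : G.R) : ℕ :=
  (Finset.univ.filter fun i => r ∈ a i).card

/-- System cost of an allocation. -/
def cost (G : GCG n) (a : Fin n → Finset G.R) : ℝ :=
  ∑ r, G.Cr r (G.load a r)

/-- User `i`'s cost in allocation `a`. -/
def ucost (G : GCG n) (i : Fin n) (a : Fin n → Finset G.R) : ℝ :=
  ∑ r ∈ a i, G.Fr r (G.load a r)

/-- `a` is an admissible allocation. -/
def Valid (G : GCG n) (a : Fin n → Finset G.R) : Prop :=
  ∀ i, a i ∈ G.act i

/-- `a` is a pure Nash equilibrium. -/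
def IsNE (G : GCG n) (a : Fin n → Finset G.R) : Prop :=
  G.Valid a ∧ ∀ i : Fin n, ∀ b ∈ G.act i,
    G.ucost i a ≤ G.ucost i (Function.update a i b)

/-- Price of anarchy of `G`: worst equilibrium cost over optimal cost. -/
noncomputable def poa (G : GCG n) : ℝ :=
  sSup {x | ∃ a, G.IsNE a ∧ x = G.cost a} /
    sInf {x | ∃ a, G.Valid a ∧ x = G.cost a}

/-- `G` is `(lam, mu)`-generalized smooth. -/
def GenSmooth (G : GCG n) (lam mu : ℝ) : Prop :=
  ∀ a a' : Fin n → Finset G.R, G.Valid a → G.Valid a' →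
    (∑ i, G.ucost i (Function.update a i (a' i))) - (∑ i, G.ucost i a) + G.cost a
      ≤ lam * G.cost a' + mu * G.cost a

end GCG

/-- `G` is generated from the basis function pairs `(Cb j, Fb j)`, `j = 1, …, m`. -/
def GeneratedFrom {n m : ℕ} (G : GCG n) (Cb Fb : Fin m → ℕ → ℝ) : Prop :=
  ∃ α : G.R → Fin m → ℝ, (∀ r j, 0 ≤ α r j) ∧
    (∀ r k, G.Cr r k = ∑ j, α r j * Cb j k) ∧
    (∀ r k, G.Fr r k = ∑ j, α r j * Fb j k)

/-- Standing assumptions on the basis pairs: `Cᶨ ≥ 0`, `Cᶨ(0) = Fᶨ(0) = Fᶨ(n+1) = 0`. -/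
def BasisOK (n : ℕ) {m : ℕ} (Cb Fb : Fin m → ℕ → ℝ) : Prop :=
  ∀ j, (∀ k, 0 ≤ Cb j k) ∧ Cb j 0 = 0 ∧ Fb j 0 = 0 ∧ Fb j (n + 1) = 0

/-- `(x, y, z) ∈ I(n)`. -/
def memI (n x y z : ℕ) : Prop :=
  x ≤ n ∧ y ≤ n ∧ z ≤ x ∧ z ≤ y ∧ z + 1 ≤ x + y ∧ x + y ≤ n + z

/-- `(x, y, z) ∈ I_R(n)`. -/
def memIR (n x y z : ℕ) : Prop :=
  memI n x y z ∧ (x + y = n + z ∨ (x - z) * (y - z) * z = 0)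

/-- Price of anarchy of the class of all generalized congestion games generated from the basis. -/
noncomputable def classPoA (n : ℕ) {m : ℕ} (Cb Fb : Fin m → ℕ → ℝ) : ℝ :=
  sSup {x | ∃ G : GCG n, GeneratedFrom G Cb Fb ∧ x = G.poa}

/-- Generalized price of anarchy of the class generated from the basis. -/
noncomputable def classGPoA (n : ℕ) {m : ℕ} (Cb Fb : Fin m → ℕ → ℝ) : ℝ :=
  sInf {x | ∃ lam mu : ℝ, 0 < lam ∧ mu < 1 ∧
    (∀ G : GCG n, GeneratedFrom G Cb Fb → G.GenSmooth lam mu) ∧ x = lam / (1 - mu)}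

/-- Feasibility of `(ν, ρ)` in the linear program of Theorem 3.4. -/
def LPfeas (n : ℕ) {m : ℕ} (Cb Fb : Fin m → ℕ → ℝ) (ν ρ : ℝ) : Prop :=
  0 ≤ ν ∧ ∀ j : Fin m, ∀ x y z : ℕ, memIR n x y z →
    0 ≤ Cb j y - ρ * Cb j x +
      ν * (((x : ℝ) - (z : ℝ)) * Fb j x - ((y : ℝ) - (z : ℝ)) * Fb j (x + 1))

/-- The number of users selecting resource `r` both in `a` and in `a'`. -/
def zload {n : ℕ} (G : GCG n) (a a' : Fin n → Finset G.R) (r : G.R) : ℕ :=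
  (Finset.univ.filter fun i : Fin n => r ∈ a i ∧ r ∈ a' i).card

/-- A user deviating onto `r` faces the old load if it already used `r`, and one more otherwise. -/
lemma GCG.load_update_of_mem {n : ℕ} (G : GCG n) (a : Fin n → Finset G.R) {i : Fin n}
    {b : Finset G.R} {r : G.R} (hr : r ∈ b) :
    G.load (Function.update a i b) r = if r ∈ a i then G.load a r else G.load a r + 1 := by
  have h : (univ.filter fun k => r ∈ Function.update a i b k) =
      insert i (univ.filter fun k => r ∈ a k) := by
    ext k
    by_cases hk : k = i
    · subst hk
      simp [hr]
    · simp [hk]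
  simp [GCG.load, h, Finset.card_insert_eq_ite]

/-- The users of `r` in `a'` split into those that also use it in `a` and those that do not. -/
lemma card_filter_notMem_add_zload {n : ℕ} (G : GCG n) (a a' : Fin n → Finset G.R) (r : G.R) :
    (univ.filter fun i => r ∈ a' i ∧ r ∉ a i).card + zload G a a' r = G.load a' r := by
  have h := Finset.card_filter_add_card_filter_not (s := univ.filter fun i => r ∈ a' i)
    (fun i => r ∈ a i)
  rw [Finset.filter_filter, Finset.filter_filter] at h
  rw [GCG.load, ← h, add_comm, zload]
  simp only [and_comm]

/-- Inclusion-exclusion for the users of `r` in `a` and in `a'`. -/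
lemma card_filter_or_add_zload {n : ℕ} (G : GCG n) (a a' : Fin n → Finset G.R) (r : G.R) :
    (univ.filter fun i => r ∈ a i ∨ r ∈ a' i).card + zload G a a' r =
      G.load a r + G.load a' r := by
  rw [zload, Finset.filter_or, Finset.filter_and, Finset.card_union_add_card_inter]
  rfl

/-- The total cost incurred on `r` by users deviating onto it. -/
lemma sum_deviation_cost {n : ℕ} (G : GCG n) (a a' : Fin n → Finset G.R) (r : G.R) :
    (∑ i, if r ∈ a' i then G.Fr r (G.load (Function.update a i (a' i)) r) else 0) =
      ((G.load a' r : ℝ) - (zload G a a' r : ℝ)) * G.Fr r (G.load a r + 1)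
        + (zload G a a' r : ℝ) * G.Fr r (G.load a r) := by
  have hterm : ∀ i, (if r ∈ a' i then G.Fr r (G.load (Function.update a i (a' i)) r) else 0) =
      (if r ∈ a' i ∧ r ∉ a i then G.Fr r (G.load a r + 1) else 0) +
        (if r ∈ a i ∧ r ∈ a' i then G.Fr r (G.load a r) else 0) := by
    intro i
    by_cases h' : r ∈ a' i
    · rw [G.load_update_of_mem a h']
      by_cases h : r ∈ a i <;> simp [h, h']
    · simp [h']
  simp_rw [hterm, Finset.sum_add_distrib, ← Finset.sum_filter, Finset.sum_const, nsmul_eq_mul]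
  rw [← card_filter_notMem_add_zload G a a' r, Nat.cast_add, add_sub_cancel_right, zload]

/-- For any two allocations `a, a'` of a generalized congestion game, with
`x_r = |a|_r`, `y_r = |a'|_r` and `z_r` the number of users selecting `r` in both, the total cost
after unilateral deviations is `∑_r (y_r - z_r)·F_r(x_r + 1) + z_r·F_r(x_r)`, and each triple
`(x_r, y_r, z_r)` satisfies `1 ≤ x_r + y_r - z_r ≤ n` (or is identically zero) and
`z_r ≤ min x_r y_r`. -/
theorem deviation_cost_decomposition {n : ℕ} (G : GCG n)
    (a a' : Fin n → Finset G.R) (ha : G.Valid a) (ha' : G.Valid a') :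
    ((∑ i, G.ucost i (Function.update a i (a' i))) =
      ∑ r : G.R, (((G.load a' r : ℝ) - (zload G a a' r : ℝ)) * G.Fr r (G.load a r + 1)
        + (zload G a a' r : ℝ) * G.Fr r (G.load a r))) ∧
    ∀ r : G.R,
      ((1 ≤ G.load a r + G.load a' r - zload G a a' r ∧
          G.load a r + G.load a' r - zload G a a' r ≤ n) ∨
        (G.load a r = 0 ∧ G.load a' r = 0 ∧ zload G a a' r = 0)) ∧
      zload G a a' r ≤ min (G.load a r) (G.load a' r) := by
  refine ⟨?_, fun r => ?_⟩
  · simp_rw [← sum_deviation_cost]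
    rw [Finset.sum_comm]
    simp [GCG.ucost, Finset.sum_ite_mem]
  · have hor := card_filter_or_add_zload G a a' r
    have hn : (univ.filter fun i => r ∈ a i ∨ r ∈ a' i).card ≤ n := by
      simpa using Finset.card_filter_le (univ : Finset (Fin n)) fun i => r ∈ a i ∨ r ∈ a' i
    have hy : zload G a a' r ≤ G.load a' r := by
      have := card_filter_notMem_add_zload G a a' r
      omega
    have hx : zload G a a' r ≤ G.load a r :=
      Finset.card_le_card (Finset.monotone_filter_right _ fun _ _ h => h.1)
    omega
end

section
/- Fix n ≥ 1, basis function pairs {C^j, F^j}, j = 1,…,m, and λ > 0, μ < 1 satisfying, for every j ∈ {1,…,m} and every (x,y,z) ∈ I(n): (z−x)·F^j(x) + (y−z)·F^j(x+1) + C^j(x) ≤ λ·C^j(y) + μ·C^j(x). Then every generalized congestion game with at most n users generated from the basis pairs {C^j, F^j} is (λ,μ)-generalized smooth. -/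
open Finset

namespace GCG

variable {n : ℕ}

/-- The number of users selecting resource `r` in both of two allocations. -/
def overlap (G : GCG n) (a a' : Fin n → Finset G.R) (r : G.R) : ℕ :=
  (Finset.univ.filter fun i => r ∈ a i ∧ r ∈ a' i).card

lemma overlap_le_left (G : GCG n) (a a' : Fin n → Finset G.R) (r : G.R) :
    G.overlap a a' r ≤ G.load a r :=
  Finset.card_le_card (Finset.monotone_filter_right _ fun _ _ h => h.1)

lemma overlap_le_right (G : GCG n) (a a' : Fin n → Finset G.R) (r : G.R) :
    G.overlap a a' r ≤ G.load a' r :=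
  Finset.card_le_card (Finset.monotone_filter_right _ fun _ _ h => h.2)

lemma load_le (G : GCG n) (a : Fin n → Finset G.R) (r : G.R) : G.load a r ≤ n := by
  simpa [load] using Finset.card_le_univ (Finset.univ.filter fun i => r ∈ a i)

lemma load_add_load_le (G : GCG n) (a a' : Fin n → Finset G.R) (r : G.R) :
    G.load a r + G.load a' r ≤ n + G.overlap a a' r := by
  unfold load overlap
  rw [← Finset.card_union_add_card_inter, ← Finset.filter_and]
  gcongr
  simpa using Finset.card_le_univ
    ((Finset.univ.filter fun i => r ∈ a i) ∪ Finset.univ.filter fun i => r ∈ a' i)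

lemma load_update (G : GCG n) (a : Fin n → Finset G.R) (i : Fin n) (b : Finset G.R)
    {r : G.R} (hr : r ∈ b) :
    G.load (Function.update a i b) r =
      if r ∈ a i then G.load a r else G.load a r + 1 := by
  have h : (Finset.univ.filter fun k => r ∈ Function.update a i b k) =
      insert i (Finset.univ.filter fun k => r ∈ a k) := by
    ext k
    by_cases hk : k = i
    · subst hk
      simp [hr]
    · simp [hk]
  simp [load, h, Finset.card_insert_eq_ite]

lemma sum_ucost (G : GCG n) (a : Fin n → Finset G.R) :
    ∑ i, G.ucost i a = ∑ r, (G.load a r : ℝ) * G.Fr r (G.load a r) := by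
  have h (i : Fin n) : G.ucost i a = ∑ r, if r ∈ a i then G.Fr r (G.load a r) else 0 := by
    simp [ucost]
  simp_rw [h]
  rw [Finset.sum_comm]
  refine Finset.sum_congr rfl fun r _ => ?_
  rw [← Finset.sum_filter, Finset.sum_const, nsmul_eq_mul]
  rfl

lemma sum_ucost_update (G : GCG n) (a a' : Fin n → Finset G.R) :
    ∑ i, G.ucost i (Function.update a i (a' i)) =
      ∑ r, ((G.overlap a a' r : ℝ) * G.Fr r (G.load a r) +
        ((G.load a' r : ℝ) - G.overlap a a' r) * G.Fr r (G.load a r + 1)) := by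
  have h (i : Fin n) : G.ucost i (Function.update a i (a' i)) =
      ∑ r, ((if r ∈ a i ∧ r ∈ a' i then G.Fr r (G.load a r) else 0) +
        ((if r ∈ a' i then G.Fr r (G.load a r + 1) else 0) -
          if r ∈ a i ∧ r ∈ a' i then G.Fr r (G.load a r + 1) else 0)) := by
    rw [ucost, Function.update_self, ← Finset.univ_inter (a' i), ← Finset.sum_ite_mem]
    refine Finset.sum_congr rfl fun r _ => ?_
    by_cases hr : r ∈ a' i
    · by_cases hr' : r ∈ a i <;> simp [load_update, hr, hr']
    · simp [hr]
  simp_rw [h]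
  rw [Finset.sum_comm]
  refine Finset.sum_congr rfl fun r _ => ?_
  simp only [Finset.sum_add_distrib, Finset.sum_sub_distrib, ← Finset.sum_filter,
    Finset.sum_const, nsmul_eq_mul, sub_mul]
  rfl

end GCG

/-- If `lam > 0` and `mu < 1` satisfy the pointwise inequalities
`(z - x)·Fᶨ(x) + (y - z)·Fᶨ(x+1) + Cᶨ(x) ≤ lam·Cᶨ(y) + mu·Cᶨ(x)` for all basis indices `j` and
all `(x, y, z) ∈ I(n)`, then every generalized congestion game with at most `n` users generated
from the basis pairs is `(lam, mu)`-generalized smooth. -/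
theorem pointwise_ineq_implies_genSmooth {n m : ℕ} (hn : 1 ≤ n)
    (Cb Fb : Fin m → ℕ → ℝ) (hbasis : BasisOK n Cb Fb)
    (lam mu : ℝ) (hlam : 0 < lam) (hmu : mu < 1)
    (hineq : ∀ j : Fin m, ∀ x y z : ℕ, memI n x y z →
      ((z : ℝ) - (x : ℝ)) * Fb j x + ((y : ℝ) - (z : ℝ)) * Fb j (x + 1) + Cb j x
        ≤ lam * Cb j y + mu * Cb j x)
    (G : GCG n) (hG : GeneratedFrom G Cb Fb) :
    G.GenSmooth lam mu := by
  obtain ⟨α, hα, hC, hF⟩ := hG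
  intro a a' _ _
  rw [G.sum_ucost_update, G.sum_ucost]
  simp only [GCG.cost, Finset.mul_sum]
  rw [← Finset.sum_sub_distrib, ← Finset.sum_add_distrib, ← Finset.sum_add_distrib]
  refine Finset.sum_le_sum fun r _ => ?_
  have hzx := G.overlap_le_left a a' r
  have hzy := G.overlap_le_right a a' r
  have hx := G.load_le a r
  have hy := G.load_le a' r
  have hxy := G.load_add_load_le a a' r
  generalize G.load a r = x at *
  generalize G.load a' r = y at *
  generalize G.overlap a a' r = z at *
  have key (j : Fin m) : ((z : ℝ) - x) * Fb j x + ((y : ℝ) - z) * Fb j (x + 1) + Cb j x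
      ≤ lam * Cb j y + mu * Cb j x := by
    by_cases hpos : z + 1 ≤ x + y
    · exact hineq j x y z ⟨hx, hy, hzx, hzy, hpos, hxy⟩
    · obtain ⟨rfl, rfl, rfl⟩ : x = 0 ∧ y = 0 ∧ z = 0 := by omega
      simp [(hbasis j).2.1]
  have hsum := Finset.sum_le_sum fun j (_ : j ∈ Finset.univ) =>
    mul_le_mul_of_nonneg_left (key j) (hα r j)
  simp only [mul_add, Finset.sum_add_distrib, mul_left_comm (α r _),
    ← Finset.mul_sum, ← hC, ← hF] at hsum
  linarith
end

section
/- Fix n ≥ 1, functions C : {0,…,n} → ℝ_{≥0} with C(0) = 0 and F : {0,…,n+1} → ℝ with F(0) = F(n+1) = 0, and reals λ > 0, μ < 1. If the inequality (z−x)·F(x) + (y−z)·F(x+1) + C(x) ≤ λ·C(y) + μ·C(x) holds for every (x,y,z) ∈ I_R(n), then it holds for every (x,y,z) ∈ I(n). That is, restricting the constraint set from I(n) to the subset I_R(n) loses no generality. -/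
open Finset

/-- The lower end of the `z`-range over fixed `(x, y)` lies in the restricted set. -/
lemma memI.memIR_lower {n x y z : ℕ} (h : memI n x y z) : memIR n x y (x + y - n) := by
  obtain ⟨hx, hy, hzx, hzy, hpos, htop⟩ := h
  refine ⟨⟨by omega, by omega, by omega, by omega, by omega, by omega⟩, ?_⟩
  rcases le_total n (x + y) with hn | hn
  · exact Or.inl (by omega)
  · exact Or.inr (by simp [Nat.sub_eq_zero_of_le hn])

/-- The upper end of the `z`-range over fixed `(x, y)` lies in the restricted set. -/
lemma memI.memIR_upper {n x y z : ℕ} (h : memI n x y z) : memIR n x y (min x y) := by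
  obtain ⟨hx, hy, hzx, hzy, hpos, htop⟩ := h
  refine ⟨⟨by omega, by omega, by omega, by omega, by omega, by omega⟩, Or.inr ?_⟩
  rcases le_total x y with hxy | hxy <;> simp [hxy]

/-- If the smoothness constraints hold for every triple in `I_R(n)`, then they
hold for every triple in `I(n)`: restricting the constraint set to `I_R(n)` loses no generality. -/
theorem constraints_IR_imply_constraints_I {n : ℕ} (hn : 1 ≤ n)
    (C F : ℕ → ℝ) (hCnn : ∀ k, 0 ≤ C k) (hC0 : C 0 = 0)
    (hF0 : F 0 = 0) (hFtop : F (n + 1) = 0)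
    (lam mu : ℝ) (hlam : 0 < lam) (hmu : mu < 1)
    (h : ∀ x y z : ℕ, memIR n x y z →
      ((z : ℝ) - (x : ℝ)) * F x + ((y : ℝ) - (z : ℝ)) * F (x + 1) + C x
        ≤ lam * C y + mu * C x) :
    ∀ x y z : ℕ, memI n x y z →
      ((z : ℝ) - (x : ℝ)) * F x + ((y : ℝ) - (z : ℝ)) * F (x + 1) + C x
        ≤ lam * C y + mu * C x := by
  intro x y z hz
  rcases le_total (F (x + 1)) (F x) with hF | hF
  · have hle : (z : ℝ) ≤ (min x y : ℕ) := by
      exact_mod_cast le_min hz.2.2.1 hz.2.2.2.1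
    linarith [h x y _ hz.memIR_upper, mul_le_mul_of_nonneg_right hle (sub_nonneg.2 hF)]
  · have hle : ((x + y - n : ℕ) : ℝ) ≤ z := by
      exact_mod_cast Nat.sub_le_iff_le_add'.2 hz.2.2.2.2.2
    linarith [h x y _ hz.memIR_lower, mul_le_mul_of_nonneg_right hle (sub_nonneg.2 hF)]
end

section
/- Fix n ≥ 1 and basis function pairs {C^j, F^j}, j = 1,…,m, with C^j(k) > 0 for some j and some k ∈ {1,…,n}. Consider the feasible set of the linear program: pairs (ν,ρ) with ν ≥ 0 and C^j(y) − ρ·C^j(x) + ν·[(x−z)·F^j(x) − (y−z)·F^j(x+1)] ≥ 0 for all j and all (x,y,z) ∈ I_R(n). Then: (a) the pair (ν,ρ) = (0,0) is feasible; (b) every feasible pair satisfies ρ ≤ 1; and (c) the supremum ρ* of ρ over the feasible set is attained, i.e., the linear program has a maximizer. -/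
open Finset

/-- A finite linear program in two variables `ν ≥ 0` and `ρ`, with constraints
`a i - ρ * b i + ν * c i ≥ 0` where `a i, b i ≥ 0`, whose objective `ρ` is bounded above on the
feasible set, has a maximizer. -/
theorem exists_isMax_of_finite_constraints {ι : Type*} [Finite ι] (a b c : ι → ℝ)
    (ha : ∀ i, 0 ≤ a i) (hb : ∀ i, 0 ≤ b i) (B : ℝ)
    (hB : ∀ ν ρ : ℝ, 0 ≤ ν → (∀ i, 0 ≤ a i - ρ * b i + ν * c i) → ρ ≤ B) :
    ∃ ν ρ : ℝ, (0 ≤ ν ∧ ∀ i, 0 ≤ a i - ρ * b i + ν * c i) ∧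
      ∀ ν' ρ' : ℝ, 0 ≤ ν' → (∀ i, 0 ≤ a i - ρ' * b i + ν' * c i) → ρ' ≤ ρ := by
  obtain ⟨M₀, hM₀⟩ := (Set.finite_range fun i => B * b i / c i).bddAbove
  set M := max M₀ 0
  have hM : ∀ i, 0 < c i → B * b i ≤ M * c i := fun i hc =>
    (div_le_iff₀ hc).1 ((hM₀ ⟨i, rfl⟩).trans (le_max_left _ _))
  have hM0 : 0 ≤ M := le_max_right _ _
  let K : Set (ℝ × ℝ) :=
    (Set.Icc 0 M ×ˢ Set.Icc 0 B) ∩ ⋂ i, {p | 0 ≤ a i - p.2 * b i + p.1 * c i}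
  have hB0 : 0 ≤ B := hB 0 0 le_rfl (by simpa using ha)
  have hK : IsCompact K :=
    (isCompact_Icc.prod isCompact_Icc).inter_right
      (isClosed_iInter fun i => isClosed_le (by fun_prop) (by fun_prop))
  have hne : K.Nonempty := ⟨(0, 0), by simpa [K, hM0, hB0] using ha⟩
  obtain ⟨⟨ν, ρ⟩, hmem, hmax⟩ := hK.exists_isMaxOn hne continuous_snd.continuousOn
  simp only [K, Set.mem_inter_iff, Set.mem_prod, Set.mem_Icc, Set.mem_iInter,
    Set.mem_ofPred_eq] at hmem
  refine ⟨ν, ρ, ⟨hmem.1.1.1, hmem.2⟩, fun ν' ρ' hν' h => ?_⟩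
  rcases lt_or_ge ρ' 0 with hρ' | hρ'
  · exact hρ'.le.trans hmem.1.2.1
  have hle : ρ' ≤ B := hB ν' ρ' hν' h
  refine hmax (a := (min ν' M, ρ')) ⟨⟨⟨le_min hν' hM0, min_le_right _ _⟩, hρ', hle⟩, ?_⟩
  simp only [Set.mem_iInter, Set.mem_ofPred_eq]
  intro i
  rcases le_total ν' M with hm | hm
  · rw [min_eq_left hm]; exact h i
  · rw [min_eq_right hm]
    rcases lt_or_ge 0 (c i) with hc | hc
    · linarith [hM i hc, ha i, mul_le_mul_of_nonneg_right hle (hb i)]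
    · linarith [h i, mul_le_mul_of_nonpos_right hm hc]

/-- For the linear program of Theorem 3.4: (a) `(ν, ρ) = (0, 0)` is feasible;
(b) every feasible pair has `ρ ≤ 1`; (c) the supremum of `ρ` over the feasible set is attained. -/
theorem lp_feasible_zero_bounded_attained {n m : ℕ} (hn : 1 ≤ n)
    (Cb Fb : Fin m → ℕ → ℝ) (hbasis : BasisOK n Cb Fb)
    (hpos : ∃ (j : Fin m) (k : ℕ), 1 ≤ k ∧ k ≤ n ∧ 0 < Cb j k) :
    LPfeas n Cb Fb 0 0 ∧
      (∀ ν ρ : ℝ, LPfeas n Cb Fb ν ρ → ρ ≤ 1) ∧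
      ∃ ν ρ : ℝ, LPfeas n Cb Fb ν ρ ∧ ∀ ν' ρ' : ℝ, LPfeas n Cb Fb ν' ρ' → ρ' ≤ ρ := by
  have hle : ∀ ν ρ : ℝ, LPfeas n Cb Fb ν ρ → ρ ≤ 1 := by
    rintro ν ρ ⟨-, h⟩
    obtain ⟨j, k, hk1, hkn, hpos⟩ := hpos
    have hjk := h j k k k ⟨⟨hkn, hkn, le_rfl, le_rfl, by omega, by omega⟩, Or.inr (by simp)⟩
    simp only [sub_self, zero_mul, mul_zero, add_zero] at hjk
    nlinarith
  refine ⟨⟨le_rfl, fun j x y z _ => by simpa using (hbasis j).1 y⟩, hle, ?_⟩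
  let ι := {t : Fin m × Fin (n + 1) × Fin (n + 1) × Fin (n + 1) // memIR n t.2.1 t.2.2.1 t.2.2.2}
  let a : ι → ℝ := fun t => Cb t.1.1 t.1.2.2.1
  let b : ι → ℝ := fun t => Cb t.1.1 t.1.2.1
  let c : ι → ℝ := fun t =>
    (((t.1.2.1 : ℕ) : ℝ) - ((t.1.2.2.2 : ℕ) : ℝ)) * Fb t.1.1 t.1.2.1 -
      (((t.1.2.2.1 : ℕ) : ℝ) - ((t.1.2.2.2 : ℕ) : ℝ)) * Fb t.1.1 (t.1.2.1 + 1)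
  have hiff : ∀ ν ρ : ℝ, LPfeas n Cb Fb ν ρ ↔ 0 ≤ ν ∧ ∀ i, 0 ≤ a i - ρ * b i + ν * c i := by
    refine fun ν ρ => and_congr_right fun _ => ⟨fun h t => h _ _ _ _ t.2, fun h j x y z ht => ?_⟩
    obtain ⟨hx, hy, hz, -⟩ := ht.1
    exact h ⟨(j, ⟨x, by omega⟩, ⟨y, by omega⟩, ⟨z, by omega⟩), ht⟩
  obtain ⟨ν, ρ, hf, hmax⟩ := exists_isMax_of_finite_constraints a b c
    (fun _ => (hbasis _).1 _) (fun _ => (hbasis _).1 _) 1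
    fun ν ρ hν h => hle ν ρ ((hiff ν ρ).2 ⟨hν, h⟩)
  exact ⟨ν, ρ, (hiff ν ρ).2 hf, fun ν' ρ' h =>
    hmax ν' ρ' ((hiff ν' ρ').1 h).1 ((hiff ν' ρ').1 h).2⟩
end

section
/- Fix n ≥ 1 and basis function pairs {W^j, F^j}, j = 1,…,m, with W^j : {0,…,n} → ℝ_{≥0}, W^j(0) = 0, and F^j : {0,…,n+1} → ℝ_{≥0} with F^j(0) = F^j(n+1) = 0, and let 𝒢 be the set of all distributed welfare games with at most n users generated from these basis pairs. Let ρ* be the optimal value of the linear program: minimize ρ over ν ∈ ℝ_{≥0}, ρ ∈ ℝ subject to W^j(y) − ρ·W^j(x) + ν·[(x−z)·F^j(x) − (y−z)·F^j(x+1)] ≤ 0 for all j = 1,…,m and all (x,y,z) ∈ I_R(n). Then PoA(𝒢) = ρ*, and moreover PoA(𝒢) = GPoA(𝒢), where GPoA(𝒢) = inf{(1+μ)/λ : λ > 0, μ > −1, every G ∈ 𝒢 is (λ,μ)-generalized smooth}. -/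
open Finset

/-- A distributed welfare game with user set `Fin n`. -/
structure DWG (n : ℕ) where
  R : Type
  finR : Fintype R
  decR : DecidableEq R
  act : Fin n → Finset (Finset R)
  act_ne : ∀ i, (act i).Nonempty
  Wr : R → ℕ → ℝ
  Fr : R → ℕ → ℝ
  Wr_nonneg : ∀ r k, 0 ≤ Wr r k
  Wr_zero : ∀ r, Wr r 0 = 0
  Fr_zero : ∀ r, Fr r 0 = 0
  Fr_top : ∀ r, Fr r (n + 1) = 0

attribute [instance] DWG.finR DWG.decR

namespace DWG

variable {n : ℕ}

/-- The number of users selecting resource `r` in allocation `a`. -/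
def load (G : DWG n) (a : Fin n → Finset G.R) (r : G.R) : ℕ :=
  (Finset.univ.filter fun i => r ∈ a i).card

/-- System welfare of an allocation. -/
def welfare (G : DWG n) (a : Fin n → Finset G.R) : ℝ :=
  ∑ r, G.Wr r (G.load a r)

/-- User `i`'s utility in allocation `a`. -/
def util (G : DWG n) (i : Fin n) (a : Fin n → Finset G.R) : ℝ :=
  ∑ r ∈ a i, G.Fr r (G.load a r)

/-- `a` is an admissible allocation. -/
def Valid (G : DWG n) (a : Fin n → Finset G.R) : Prop :=
  ∀ i, a i ∈ G.act i

/-- `a` is a pure Nash equilibrium. -/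
def IsNE (G : DWG n) (a : Fin n → Finset G.R) : Prop :=
  G.Valid a ∧ ∀ i : Fin n, ∀ b ∈ G.act i,
    G.util i (Function.update a i b) ≤ G.util i a

/-- Price of anarchy of `G`: optimal welfare over worst equilibrium welfare. -/
noncomputable def poa (G : DWG n) : ℝ :=
  sSup {x | ∃ a, G.Valid a ∧ x = G.welfare a} /
    sInf {x | ∃ a, G.IsNE a ∧ x = G.welfare a}

/-- `G` is `(lam, mu)`-generalized smooth (welfare maximization version). -/
def GenSmooth (G : DWG n) (lam mu : ℝ) : Prop :=
  ∀ a a' : Fin n → Finset G.R, G.Valid a → G.Valid a' →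
    lam * G.welfare a' - mu * G.welfare a ≤
      (∑ i, G.util i (Function.update a i (a' i))) - (∑ i, G.util i a) + G.welfare a

end DWG

/-- `G` is generated from the basis function pairs `(Wb j, Fb j)`, `j = 1, …, m`. -/
def GeneratedFromW {n m : ℕ} (G : DWG n) (Wb Fb : Fin m → ℕ → ℝ) : Prop :=
  ∃ α : G.R → Fin m → ℝ, (∀ r j, 0 ≤ α r j) ∧
    (∀ r k, G.Wr r k = ∑ j, α r j * Wb j k) ∧
    (∀ r k, G.Fr r k = ∑ j, α r j * Fb j k)

/-- Price of anarchy of the class of all distributed welfare games generated from the basis. -/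
noncomputable def classPoAW (n : ℕ) {m : ℕ} (Wb Fb : Fin m → ℕ → ℝ) : ℝ :=
  sSup {x | ∃ G : DWG n, GeneratedFromW G Wb Fb ∧ x = G.poa}

/-- Generalized price of anarchy of the class generated from the basis. -/
noncomputable def classGPoAW (n : ℕ) {m : ℕ} (Wb Fb : Fin m → ℕ → ℝ) : ℝ :=
  sInf {x | ∃ lam mu : ℝ, 0 < lam ∧ -1 < mu ∧
    (∀ G : DWG n, GeneratedFromW G Wb Fb → G.GenSmooth lam mu) ∧ x = (1 + mu) / lam}

/-- Feasibility of `(ν, ρ)` in the linear program of Theorem 4.3 (ii). -/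
def LPfeasW (n : ℕ) {m : ℕ} (Wb Fb : Fin m → ℕ → ℝ) (ν ρ : ℝ) : Prop :=
  0 ≤ ν ∧ ∀ j : Fin m, ∀ x y z : ℕ, memIR n x y z →
    Wb j y - ρ * Wb j x +
      ν * (((x : ℝ) - (z : ℝ)) * Fb j x - ((y : ℝ) - (z : ℝ)) * Fb j (x + 1)) ≤ 0

/-- A homogeneous alternative for finitely many linear constraints on one nonnegative variable:
if no `ν ≥ 0` satisfies them all, two of them have a contradictory nonnegative combination. -/
theorem exists_pair_of_infeasible {ι : Type*} [Fintype ι] (C D : ι → ℝ)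
    (h : ¬ ∃ ν : ℝ, 0 ≤ ν ∧ ∀ k, ν * C k ≤ D k) :
    ∃ (k l : ι) (s t : ℝ), 0 ≤ s ∧ 0 ≤ t ∧ 0 ≤ s * C k + t * C l ∧ s * D k + t * D l < 0 := by
  classical
  by_contra! H
  have hnonneg : ∀ k, 0 ≤ C k → 0 ≤ D k := fun k hk => by
    simpa using H k k 1 0 zero_le_one le_rfl (by simpa using hk)
  apply h
  by_cases hpos : (univ.filter fun k => 0 < C k).Nonempty
  · obtain ⟨k, hk, hmin⟩ := exists_min_image _ (fun k => D k / C k) hpos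
    have hCk : 0 < C k := (mem_filter.1 hk).2
    refine ⟨D k / C k, div_nonneg (hnonneg k hCk.le) hCk.le, fun l => ?_⟩
    rcases lt_trichotomy (C l) 0 with hl | hl | hl
    · have := H k l (-C l) (C k) (by linarith) hCk.le (by linarith)
      rw [div_mul_eq_mul_div, div_le_iff₀ hCk]
      linarith
    · simpa [hl] using hnonneg l hl.ge
    · exact (le_div_iff₀ hl).1 (hmin l (by simp [hl]))
  · have hC : ∀ k, C k ≤ 0 := fun k => by
      by_contra! hk
      exact hpos ⟨k, by simp [hk]⟩
    refine ⟨∑ k, |D k / C k|, sum_nonneg fun _ _ => abs_nonneg _, fun l => ?_⟩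
    rcases (hC l).lt_or_eq with hl | hl
    · rw [← div_le_iff_of_neg hl]
      exact (le_abs_self _).trans
        (single_le_sum (f := fun k => |D k / C k|) (fun _ _ => abs_nonneg _) (mem_univ l))
    · simpa [hl] using hnonneg l hl.ge

/-- Summing a value depending only on membership in `P` over the elements of `Q`. -/
theorem sum_ite_ite_eq_card {ι : Type*} [Fintype ι] (P Q : ι → Prop) [DecidablePred P]
    [DecidablePred Q] (u v : ℝ) :
    ∑ i, (if Q i then (if P i then u else v) else 0) =
      ((univ.filter fun i => P i ∧ Q i).card : ℝ) * u +
        (((univ.filter Q).card : ℝ) - (univ.filter fun i => P i ∧ Q i).card) * v := by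
  simp only [card_filter, Nat.cast_sum, ← sum_sub_distrib, sum_mul, ← sum_add_distrib]
  refine sum_congr rfl fun i _ => ?_
  by_cases hP : P i <;> by_cases hQ : Q i <;> simp [hP, hQ]

/-- The linear program constraints on `I_R(n)` imply those on all of `I(n)`, and at the origin. -/
theorem LPfeasW.constraint {n m : ℕ} {Wb Fb : Fin m → ℕ → ℝ} {ν ρ : ℝ}
    (h : LPfeasW n Wb Fb ν ρ) {j : Fin m} (hW : Wb j 0 = 0) {x y z : ℕ}
    (hx : x ≤ n) (hy : y ≤ n) (hzx : z ≤ x) (hzy : z ≤ y) (hxy : x + y ≤ n + z) :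
    Wb j y - ρ * Wb j x +
      ν * (((x : ℝ) - (z : ℝ)) * Fb j x - ((y : ℝ) - (z : ℝ)) * Fb j (x + 1)) ≤ 0 := by
  rcases Nat.eq_zero_or_pos (x + y) with h0 | h0
  · obtain ⟨rfl, rfl⟩ : x = 0 ∧ y = 0 := by omega
    obtain rfl : z = 0 := by omega
    simp [hW]
  have hlo : memIR n x y (x + y - n) := by
    refine ⟨⟨hx, hy, by omega, by omega, by omega, by omega⟩, ?_⟩
    rcases le_total n (x + y) with h1 | h1
    · left; omega
    · right; simp [Nat.sub_eq_zero_of_le h1]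
  have hhi : memIR n x y (min x y) := by
    refine ⟨⟨hx, hy, by omega, by omega, by omega, by omega⟩, Or.inr ?_⟩
    rcases le_total x y with h1 | h1 <;> simp [h1]
  have e1 := h.2 j x y _ hlo
  have e2 := h.2 j x y _ hhi
  have hl : ((x + y - n : ℕ) : ℝ) ≤ z := by exact_mod_cast (by omega : x + y - n ≤ z)
  have hu : (z : ℝ) ≤ ((min x y : ℕ) : ℝ) := by exact_mod_cast (by omega : z ≤ min x y)
  generalize ((x + y - n : ℕ) : ℝ) = l at *
  generalize ((min x y : ℕ) : ℝ) = u at *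
  rcases le_total 0 (ν * (Fb j (x + 1) - Fb j x)) with hs | hs
  · have := mul_le_mul_of_nonneg_right hu hs
    linarith
  · have := mul_le_mul_of_nonpos_right hl hs
    linarith

namespace DWG

variable {n : ℕ} (G : DWG n)

theorem load_le (a : Fin n → Finset G.R) (r : G.R) : G.load a r ≤ n := by
  simpa [load] using card_filter_le (univ : Finset (Fin n)) fun i => r ∈ a i

theorem load_update (a : Fin n → Finset G.R) (i : Fin n) (b : Finset G.R) (r : G.R)
    (hr : r ∈ b) :
    G.load (Function.update a i b) r = if r ∈ a i then G.load a r else G.load a r + 1 := by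
  have hins : (univ.filter fun k => r ∈ Function.update a i b k) =
      insert i (univ.filter fun k => r ∈ a k) := by
    ext k
    by_cases hk : k = i
    · subst hk; simp [hr]
    · simp [hk]
  unfold load
  rw [hins]
  split_ifs with h
  · rw [insert_eq_of_mem (by simp [h])]
  · rw [card_insert_of_notMem (by simp [h])]

theorem util_eq (i : Fin n) (a : Fin n → Finset G.R) :
    G.util i a = ∑ r, if r ∈ a i then G.Fr r (G.load a r) else 0 := by
  simp [util]

theorem util_update (a : Fin n → Finset G.R) (i : Fin n) (b : Finset G.R) :
    G.util i (Function.update a i b) = ∑ r, if r ∈ b then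
      (if r ∈ a i then G.Fr r (G.load a r) else G.Fr r (G.load a r + 1)) else 0 := by
  rw [util_eq]
  refine sum_congr rfl fun r _ => ?_
  rw [Function.update_self]
  split_ifs with h1 h2
  · rw [load_update _ _ _ _ _ h1, if_pos h2]
  · rw [load_update _ _ _ _ _ h1, if_neg h2]
  · rfl

theorem sum_util (a : Fin n → Finset G.R) :
    ∑ i, G.util i a = ∑ r, (G.load a r : ℝ) * G.Fr r (G.load a r) := by
  simp_rw [util_eq]
  rw [sum_comm]
  refine sum_congr rfl fun r _ => ?_
  rw [← sum_filter, sum_const, nsmul_eq_mul, load]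

theorem sum_util_update (a a' : Fin n → Finset G.R) :
    ∑ i, G.util i (Function.update a i (a' i)) =
      ∑ r, (((univ.filter fun i => r ∈ a i ∧ r ∈ a' i).card : ℝ) * G.Fr r (G.load a r) +
        ((G.load a' r : ℝ) - (univ.filter fun i => r ∈ a i ∧ r ∈ a' i).card) *
          G.Fr r (G.load a r + 1)) := by
  simp_rw [util_update]
  rw [sum_comm]
  exact sum_congr rfl fun r _ => sum_ite_ite_eq_card _ _ _ _

theorem welfare_nonneg (a : Fin n → Finset G.R) : 0 ≤ G.welfare a :=
  sum_nonneg fun r _ => G.Wr_nonneg r _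

variable {G}

theorem GenSmooth.welfare_le {lam mu : ℝ} (hs : G.GenSmooth lam mu) (hlam : 0 < lam)
    {a a' : Fin n → Finset G.R} (ha : G.IsNE a) (ha' : G.Valid a') :
    G.welfare a' ≤ (1 + mu) / lam * G.welfare a := by
  have h1 := hs a a' ha.1 ha'
  have h2 : ∑ i, G.util i (Function.update a i (a' i)) ≤ ∑ i, G.util i a :=
    sum_le_sum fun i _ => ha.2 i _ (ha' i)
  rw [div_mul_eq_mul_div, le_div_iff₀ hlam]
  linarith

theorem GenSmooth.poa_le {lam mu : ℝ} (hs : G.GenSmooth lam mu) (hlam : 0 < lam)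
    (hmu : -1 < mu) : G.poa ≤ (1 + mu) / lam := by
  have hc : 0 < (1 + mu) / lam := div_pos (by linarith) hlam
  unfold poa
  rcases Set.eq_empty_or_nonempty {x | ∃ a, G.IsNE a ∧ x = G.welfare a} with he | hne
  · rw [he, Real.sInf_empty, div_zero]
    exact hc.le
  have hnn : 0 ≤ sInf {x | ∃ a, G.IsNE a ∧ x = G.welfare a} := by
    apply Real.sInf_nonneg
    rintro _ ⟨a, -, rfl⟩
    exact G.welfare_nonneg a
  refine div_le_of_le_mul₀ hnn hc.le (Real.sSup_le ?_ (mul_nonneg hc.le hnn))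
  rintro _ ⟨a', ha', rfl⟩
  rw [← div_le_iff₀' hc]
  refine le_csInf hne ?_
  rintro _ ⟨a, ha, rfl⟩
  rw [div_le_iff₀' hc]
  exact hs.welfare_le hlam ha ha'

/-- Generalized smoothness rules out equilibria of zero welfare, so that any pair of an equilibrium
and a valid allocation of positive welfare bounds the price of anarchy from below. -/
theorem GenSmooth.le_poa {lam mu ρ : ℝ} (hs : G.GenSmooth lam mu) (hlam : 0 < lam)
    (hmu : -1 < mu) (hρ : 0 ≤ ρ) {a a' : Fin n → Finset G.R} (ha : G.IsNE a)
    (ha' : G.Valid a') (h : ρ * G.welfare a < G.welfare a') : ρ ≤ G.poa := by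
  have hc : 0 < (1 + mu) / lam := div_pos (by linarith) hlam
  have hW' : 0 < G.welfare a' := (mul_nonneg hρ (G.welfare_nonneg a)).trans_lt h
  have hpos : 0 < sInf {x | ∃ a, G.IsNE a ∧ x = G.welfare a} := by
    refine (div_pos hW' hc).trans_le (le_csInf ⟨_, a, ha, rfl⟩ ?_)
    rintro _ ⟨b, hb, rfl⟩
    rw [div_le_iff₀' hc]
    exact hs.welfare_le hlam hb ha'
  have hinf : sInf {x | ∃ a, G.IsNE a ∧ x = G.welfare a} ≤ G.welfare a := by
    refine csInf_le ⟨0, ?_⟩ ⟨a, ha, rfl⟩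
    rintro _ ⟨b, -, rfl⟩
    exact G.welfare_nonneg b
  have hsup : G.welfare a' ≤ sSup {x | ∃ a, G.Valid a ∧ x = G.welfare a} := by
    refine le_csSup ((Set.finite_range G.welfare).subset ?_).bddAbove ⟨a', ha', rfl⟩
    rintro _ ⟨b, -, rfl⟩
    exact ⟨b, rfl⟩
  unfold poa
  rw [le_div_iff₀ hpos]
  exact ((mul_le_mul_of_nonneg_left hinf hρ).trans h.le).trans hsup

end DWG

/-- A feasible point of the linear program with `ν > 0` yields generalized smoothness. -/
theorem LPfeasW.genSmooth {n m : ℕ} {Wb Fb : Fin m → ℕ → ℝ} {ν ρ : ℝ}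
    (h : LPfeasW n Wb Fb ν ρ) (hν : 0 < ν) (hW : ∀ j, Wb j 0 = 0) {G : DWG n}
    (hG : GeneratedFromW G Wb Fb) : G.GenSmooth (1 / ν) (ρ / ν - 1) := by
  intro a a' _ _
  obtain ⟨α, hα, hWr, hFr⟩ := hG
  have key : ∀ r, G.Wr r (G.load a' r) - ρ * G.Wr r (G.load a r) +
      ν * (((G.load a r : ℝ) - (univ.filter fun i => r ∈ a i ∧ r ∈ a' i).card) *
          G.Fr r (G.load a r) -
        ((G.load a' r : ℝ) - (univ.filter fun i => r ∈ a i ∧ r ∈ a' i).card) *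
          G.Fr r (G.load a r + 1)) ≤ 0 := by
    intro r
    have hzx : (univ.filter fun i => r ∈ a i ∧ r ∈ a' i).card ≤ G.load a r :=
      card_le_card fun i => by simp +contextual
    have hzy : (univ.filter fun i => r ∈ a i ∧ r ∈ a' i).card ≤ G.load a' r :=
      card_le_card fun i => by simp +contextual
    have hxy : G.load a r + G.load a' r ≤
        n + (univ.filter fun i => r ∈ a i ∧ r ∈ a' i).card := by
      have h1 := card_union_add_card_inter (univ.filter fun i => r ∈ a i)
        (univ.filter fun i => r ∈ a' i)
      have h2 := card_le_univ ((univ.filter fun i => r ∈ a i) ∪ univ.filter fun i => r ∈ a' i)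
      rw [← filter_and] at h1
      rw [Fintype.card_fin] at h2
      unfold DWG.load
      omega
    have hj := sum_nonpos fun j (_ : j ∈ univ) => mul_nonpos_of_nonneg_of_nonpos (hα r j)
      (h.constraint (hW j) (G.load_le a r) (G.load_le a' r) hzx hzy hxy)
    simp only [hWr, hFr]
    refine le_of_eq_of_le ?_ hj
    simp only [mul_sum, ← sum_sub_distrib, ← sum_add_distrib]
    exact sum_congr rfl fun j _ => by ring
  have hsum := sum_nonpos fun r (_ : r ∈ univ) => key r
  have e : G.welfare a' - ρ * G.welfare a +
      ν * (∑ i, G.util i a - ∑ i, G.util i (Function.update a i (a' i))) ≤ 0 := by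
    refine le_of_eq_of_le ?_ hsum
    rw [G.sum_util, G.sum_util_update, DWG.welfare, DWG.welfare]
    simp only [mul_sum, ← sum_sub_distrib, ← sum_add_distrib]
    exact sum_congr rfl fun r _ => by ring
  have e2 := div_nonpos_of_nonpos_of_nonneg e hν.le
  have e3 : (G.welfare a' - ρ * G.welfare a +
      ν * (∑ i, G.util i a - ∑ i, G.util i (Function.update a i (a' i)))) / ν =
      1 / ν * G.welfare a' - ρ / ν * G.welfare a +
        (∑ i, G.util i a - ∑ i, G.util i (Function.update a i (a' i))) := by
    field_simp
  linarith

theorem card_filter_val_mem_Ico {n s t : ℕ} (ht : t ≤ n) :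
    (univ.filter fun p : Fin n => s ≤ p.val ∧ p.val < t).card = t - s := by
  rw [← card_map Fin.valEmbedding, ← Nat.card_Ico]
  congr 1
  ext q
  simp only [mem_map, mem_filter, mem_univ, true_and, Fin.valEmbedding_apply, mem_Ico]
  exact ⟨by rintro ⟨p, hp, rfl⟩; exact hp, fun hq => ⟨⟨q, hq.2.trans_le ht⟩, hq, rfl⟩⟩

/-- Cyclic shifts preserve the number of points of an interval. -/
theorem card_filter_add_val_mem_Ico {n s t : ℕ} [NeZero n] (ht : t ≤ n) (c : Fin n) :
    (univ.filter fun i : Fin n => s ≤ (i + c).val ∧ (i + c).val < t).card = t - s := by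
  rw [← card_filter_val_mem_Ico ht (s := s)]
  refine card_bij (fun i _ => i + c) (fun i hi => by simpa using hi)
    (fun i _ j _ h => add_right_cancel h) (fun p hp => ⟨p - c, ?_, ?_⟩)
  · simpa using hp
  · simp

/-- A family of resource types `k : K` with prescribed weights `θ k` and profiles
`(x k, y k, z k)`, replicated cyclically, gives a game whose equilibrium condition and welfares
are the corresponding weighted sums. -/
theorem exists_cyclic_game {n m : ℕ} (hn : 1 ≤ n) {Wb Fb : Fin m → ℕ → ℝ}
    (hWb : ∀ j, (∀ k, 0 ≤ Wb j k) ∧ Wb j 0 = 0)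
    (hFb : ∀ j, (∀ k, 0 ≤ Fb j k) ∧ Fb j 0 = 0 ∧ Fb j (n + 1) = 0)
    {K : Type} [Fintype K] (J : K → Fin m) (x y z : K → ℕ) (θ : K → ℝ) (hθ : ∀ k, 0 ≤ θ k)
    (hI : ∀ k, memI n (x k) (y k) (z k))
    (hNE : 0 ≤ ∑ k, θ k * (((x k : ℝ) - z k) * Fb (J k) (x k) -
      ((y k : ℝ) - z k) * Fb (J k) (x k + 1))) :
    ∃ (G : DWG n) (a a' : Fin n → Finset G.R), GeneratedFromW G Wb Fb ∧ G.IsNE a ∧ G.Valid a' ∧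
      G.welfare a = n * ∑ k, θ k * Wb (J k) (x k) ∧
      G.welfare a' = n * ∑ k, θ k * Wb (J k) (y k) := by
  classical
  have : NeZero n := ⟨by omega⟩
  let b : Fin n → Finset (K × Fin n) := fun i =>
    univ.filter fun r => 0 ≤ (i + r.2).val ∧ (i + r.2).val < x r.1
  let b' : Fin n → Finset (K × Fin n) := fun i =>
    univ.filter fun r => x r.1 - z r.1 ≤ (i + r.2).val ∧
      (i + r.2).val < x r.1 - z r.1 + y r.1
  let G : DWG n :=
    { R := K × Fin n
      finR := inferInstance
      decR := inferInstance
      act := fun i => {b i, b' i}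
      act_ne := fun i => ⟨b i, by simp⟩
      Wr := fun r k => θ r.1 * Wb (J r.1) k
      Fr := fun r k => θ r.1 * Fb (J r.1) k
      Wr_nonneg := fun r k => mul_nonneg (hθ _) ((hWb _).1 _)
      Wr_zero := fun r => by simp [(hWb _).2]
      Fr_zero := fun r => by simp [(hFb _).2.1]
      Fr_top := fun r => by simp [(hFb _).2.2] }
  have hx : ∀ r : K × Fin n, G.load b r = x r.1 := fun r => by
    have := card_filter_add_val_mem_Ico (s := 0) (hI r.1).1 r.2
    simpa [DWG.load, b, G] using this
  have hy : ∀ r : K × Fin n, G.load b' r = y r.1 := fun r => by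
    obtain ⟨h1, h2, h3, h4, h5, h6⟩ := hI r.1
    have := card_filter_add_val_mem_Ico (n := n) (s := x r.1 - z r.1)
      (t := x r.1 - z r.1 + y r.1) (by omega) r.2
    rw [Nat.add_sub_cancel_left] at this
    simpa [DWG.load, b', G] using this
  have hmem : ∀ i (r : K × Fin n), r ∈ b i ↔ 0 ≤ (r.2 + i).val ∧ (r.2 + i).val < x r.1 :=
    fun i r => by simp [b, add_comm]
  have hmem' : ∀ i (r : K × Fin n), r ∈ b' i ↔ x r.1 - z r.1 ≤ (r.2 + i).val ∧
      (r.2 + i).val < x r.1 - z r.1 + y r.1 :=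
    fun i r => by simp [b', add_comm]
  have hcx : ∀ i k, (univ.filter fun c : Fin n => (k, c) ∈ b i).card = x k := fun i k => by
    simp only [hmem]
    rw [card_filter_add_val_mem_Ico (hI k).1, Nat.sub_zero]
  have hcy : ∀ i k, (univ.filter fun c : Fin n => (k, c) ∈ b' i).card = y k := fun i k => by
    obtain ⟨h1, h2, h3, h4, h5, h6⟩ := hI k
    simp only [hmem']
    rw [card_filter_add_val_mem_Ico (by omega), Nat.add_sub_cancel_left]
  have hcz : ∀ i k, (univ.filter fun c : Fin n => (k, c) ∈ b i ∧ (k, c) ∈ b' i).card = z k :=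
    fun i k => by
      obtain ⟨h1, h2, h3, h4, h5, h6⟩ := hI k
      have h := card_filter_add_val_mem_Ico (n := n) (s := x k - z k) h1 i
      rw [Nat.sub_sub_self h3] at h
      rw [← h]
      congr 1
      ext c
      simp only [hmem, hmem', mem_filter, mem_univ, true_and]
      omega
  refine ⟨G, b, b', ⟨fun r j => if j = J r.1 then θ r.1 else 0, ?_, ?_, ?_⟩, ⟨?_, ?_⟩, ?_, ?_, ?_⟩
  · intro r j
    dsimp only
    split_ifs
    exacts [hθ _, le_rfl]
  · intro r k
    simp [G]
  · intro r k
    simp [G]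
  · exact fun i => by simp [G]
  · intro i c hc
    rcases mem_insert.1 hc with rfl | hc
    · rw [Function.update_eq_self]
    rw [mem_singleton] at hc
    subst hc
    have e1 : G.util i b = ∑ k, θ k * ((x k : ℝ) * Fb (J k) (x k)) := by
      rw [G.util_eq]
      simp only [hx]
      refine (Fintype.sum_prod_type _).trans (sum_congr rfl fun k _ => ?_)
      dsimp only [G]
      rw [← sum_filter, sum_const, nsmul_eq_mul, hcx]
      ring
    have e2 : G.util i (Function.update b i (b' i)) = ∑ k, θ k * ((z k : ℝ) * Fb (J k) (x k) +
        ((y k : ℝ) - z k) * Fb (J k) (x k + 1)) := by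
      rw [G.util_update]
      simp only [hx]
      refine (Fintype.sum_prod_type _).trans (sum_congr rfl fun k _ => ?_)
      dsimp only [G]
      refine (sum_ite_ite_eq_card (fun c : Fin n => (k, c) ∈ b i) (fun c => (k, c) ∈ b' i)
        _ _).trans ?_
      rw [hcz, hcy]
      ring
    rw [e1, e2, ← sub_nonneg, ← sum_sub_distrib]
    refine hNE.trans_eq (sum_congr rfl fun k _ => ?_)
    ring
  · exact fun i => by simp [G]
  · simp only [DWG.welfare, hx]
    refine (Fintype.sum_prod_type _).trans ?_
    simp [G, mul_sum]
  · simp only [DWG.welfare, hy]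
    refine (Fintype.sum_prod_type _).trans ?_
    simp [G, mul_sum]

/-- Values of `ρ` infeasible for the linear program are beaten by an equilibrium of some game. -/
theorem exists_game_of_not_feasible {n m : ℕ} (hn : 1 ≤ n) {Wb Fb : Fin m → ℕ → ℝ}
    (hWb : ∀ j, (∀ k, 0 ≤ Wb j k) ∧ Wb j 0 = 0)
    (hFb : ∀ j, (∀ k, 0 ≤ Fb j k) ∧ Fb j 0 = 0 ∧ Fb j (n + 1) = 0)
    {ρ : ℝ} (hρ : ¬ ∃ ν, LPfeasW n Wb Fb ν ρ) :
    ∃ (G : DWG n) (a a' : Fin n → Finset G.R), GeneratedFromW G Wb Fb ∧ G.IsNE a ∧ G.Valid a' ∧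
      ρ * G.welfare a < G.welfare a' := by
  classical
  let ι := {q : Fin m × Fin (n + 1) × Fin (n + 1) × Fin (n + 1) //
    memI n q.2.1 q.2.2.1 q.2.2.2}
  let C : ι → ℝ := fun q => (((q.1.2.1 : ℕ) : ℝ) - (q.1.2.2.2 : ℕ)) * Fb q.1.1 q.1.2.1 -
    (((q.1.2.2.1 : ℕ) : ℝ) - (q.1.2.2.2 : ℕ)) * Fb q.1.1 ((q.1.2.1 : ℕ) + 1)
  let D : ι → ℝ := fun q => ρ * Wb q.1.1 q.1.2.1 - Wb q.1.1 q.1.2.2.1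
  have hinf : ¬ ∃ ν : ℝ, 0 ≤ ν ∧ ∀ k, ν * C k ≤ D k := by
    rintro ⟨ν, hν, h⟩
    refine hρ ⟨ν, hν, fun j x y z hxyz => ?_⟩
    obtain ⟨hI, -⟩ := hxyz
    obtain ⟨h1, h2, h3, h4, h5, h6⟩ := id hI
    have := h ⟨(j, ⟨x, by omega⟩, ⟨y, by omega⟩, ⟨z, by omega⟩), hI⟩
    dsimp only [C, D] at this
    linarith
  obtain ⟨k, l, s, t, hs, ht, hC, hD⟩ := exists_pair_of_infeasible C D hinf
  let q : Fin 2 → ι := ![k, l]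
  obtain ⟨G, a, a', hG, hNE, hV, e, e'⟩ := exists_cyclic_game hn hWb hFb (K := Fin 2)
    (fun c => (q c).1.1) (fun c => (q c).1.2.1) (fun c => (q c).1.2.2.1)
    (fun c => (q c).1.2.2.2) ![s, t] (fun c => by fin_cases c <;> simpa)
    (fun c => (q c).2) (by simpa [q, C] using hC)
  refine ⟨G, a, a', hG, hNE, hV, ?_⟩
  have hn' : (0 : ℝ) < n := by exact_mod_cast hn
  have := mul_neg_of_pos_of_neg hn' hD
  rw [e, e']
  simp only [Fin.sum_univ_two, q, D, Matrix.cons_val_zero, Matrix.cons_val_one] at this ⊢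
  linarith

/-- If the linear program has a minimum, its value and the multiplier `ν` are positive. -/
theorem LPfeasW.pos_of_isLeast {n m : ℕ} {Wb Fb : Fin m → ℕ → ℝ}
    (hWb : ∀ j, (∀ k, 0 ≤ Wb j k) ∧ Wb j 0 = 0) {ν ρ : ℝ} (h : LPfeasW n Wb Fb ν ρ)
    (hmin : ρ ∈ lowerBounds {ρ | ∃ ν, LPfeasW n Wb Fb ν ρ}) : 0 < ν ∧ 0 < ρ := by
  obtain ⟨j, y, hy, hWy⟩ : ∃ j y, y ≤ n ∧ 0 < Wb j y := by
    by_contra! H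
    have hz : ∀ j y, y ≤ n → Wb j y = 0 := fun j y hy => le_antisymm (H j y hy) ((hWb j).1 y)
    have : ρ ≤ ρ - 1 := hmin ⟨0, le_rfl, fun j x y z hI => by
      simp [hz j x hI.1.1, hz j y hI.1.2.1]⟩
    linarith
  have hy0 : y ≠ 0 := by
    rintro rfl
    exact hWy.ne' (hWb j).2
  have e1 := h.2 j 0 y 0 ⟨⟨by omega, hy, le_rfl, by omega, by omega, by omega⟩, by simp⟩
  have e2 := h.2 j 1 0 0 ⟨⟨by omega, by omega, by omega, le_rfl, by omega, by omega⟩, by simp⟩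
  simp only [(hWb j).2, Nat.cast_zero, Nat.cast_one, zero_add, sub_zero, zero_mul, mul_zero,
    zero_sub, one_mul] at e1 e2
  have hν : 0 < ν := h.1.lt_of_ne (by rintro rfl; linarith)
  have hF : 0 < ν * Fb j 1 := by
    have : 0 < (y : ℝ) * (ν * Fb j 1) := by linarith
    exact pos_of_mul_pos_right this (Nat.cast_nonneg y)
  exact ⟨hν, pos_of_mul_pos_left (by linarith : 0 < ρ * Wb j 1) ((hWb j).1 1)⟩

/-- Let `ρ*` be the optimal value of the linear program of Theorem 4.3 (ii).
Then `PoA(𝒢) = ρ*` and `PoA(𝒢) = GPoA(𝒢)` for the class of distributed welfare games with at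
most `n` users generated from the basis pairs `(Wᶨ, Fᶨ)`. -/
theorem classPoAW_eq_lp_value {n m : ℕ} (hn : 1 ≤ n)
    (Wb Fb : Fin m → ℕ → ℝ)
    (hWb : ∀ j, (∀ k, 0 ≤ Wb j k) ∧ Wb j 0 = 0)
    (hFb : ∀ j, (∀ k, 0 ≤ Fb j k) ∧ Fb j 0 = 0 ∧ Fb j (n + 1) = 0)
    (ρstar : ℝ) (hopt : IsLeast {ρ | ∃ ν, LPfeasW n Wb Fb ν ρ} ρstar) :
    classPoAW n Wb Fb = ρstar ∧ classPoAW n Wb Fb = classGPoAW n Wb Fb := by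
  obtain ⟨⟨ν, hfeas⟩, hmin⟩ := hopt
  obtain ⟨hν, hρ⟩ := hfeas.pos_of_isLeast hWb hmin
  have hsm : ∀ G : DWG n, GeneratedFromW G Wb Fb → G.GenSmooth (1 / ν) (ρstar / ν - 1) :=
    fun G hG => hfeas.genSmooth hν (fun j => (hWb j).2) hG
  have hlam : 0 < 1 / ν := one_div_pos.2 hν
  have hmu : -1 < ρstar / ν - 1 := by linarith [div_pos hρ hν]
  have hval : ρstar = (1 + (ρstar / ν - 1)) / (1 / ν) := by field_simp; ring
  have hle : classPoAW n Wb Fb ≤ classGPoAW n Wb Fb := by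
    refine le_csInf ⟨_, _, _, hlam, hmu, hsm, rfl⟩ ?_
    rintro _ ⟨lam, mu, hl, hm, hs, rfl⟩
    refine Real.sSup_le ?_ (div_pos (by linarith) hl).le
    rintro _ ⟨G, hG, rfl⟩
    exact (hs G hG).poa_le hl hm
  have hge : classGPoAW n Wb Fb ≤ ρstar := by
    refine csInf_le ⟨0, ?_⟩ ⟨_, _, hlam, hmu, hsm, hval⟩
    rintro _ ⟨lam, mu, hl, hm, -, rfl⟩
    exact (div_pos (by linarith) hl).le
  have hbdd : BddAbove {x | ∃ G : DWG n, GeneratedFromW G Wb Fb ∧ x = G.poa} := by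
    refine ⟨ρstar, ?_⟩
    rintro _ ⟨G, hG, rfl⟩
    exact hval ▸ (hsm G hG).poa_le hlam hmu
  have hlow : ρstar ≤ classPoAW n Wb Fb := by
    refine le_of_forall_lt_imp_le_of_dense fun ρ hlt => ?_
    have hlt' : max ρ 0 < ρstar := max_lt hlt hρ
    obtain ⟨G, a, a', hG, ha, ha', hw⟩ := exists_game_of_not_feasible hn hWb hFb
      fun hex => (hmin hex).not_gt hlt'
    exact (le_max_left ρ 0).trans (((hsm G hG).le_poa hlam hmu (le_max_right ρ 0) ha ha' hw).trans
      (le_csSup hbdd ⟨G, hG, rfl⟩))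
  exact ⟨le_antisymm (hle.trans hge) hlow, le_antisymm hle (hge.trans hlow)⟩
end
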